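/- arXiv:1905.10473 — 3 statements merged into one kernel-verified Lean document; each statement's English description precedes it below -/
import Mathlib

section
/- Let (A,X) be a C*-correspondence such that the closed linear span of {a·x : a ∈ J_X, x ∈ X} equals X. Then (A,X) is hyperrigid. -/
/-!
Common framework: Hilbert C*-modules, C*-correspondences, compact operators,
the Katsura ideal, Toeplitz pairs, covariance, Cuntz-Pimsner algebras,
completely positive completely contractive maps, and hyperrigidity.
-/

noncomputable section

open Filter Topology Set
open scoped ComplexOrder InnerProductSpace

universe u v w u'

/-- A right Hilbert C*-module `X` over a (possibly non-unital) C*-algebra `A`.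
`smulR x a` is the right action `x·a`, and `inner x y` is the `A`-valued inner
product `⟨x,y⟩`, conjugate-linear in the first variable.  The Cauchy-Schwarz
inequality `norm_inner_le` and `norm_smulR_le` are consequences of the other
axioms which we record as fields for convenience. -/
structure HilbertModule (A : Type u) (X : Type v) [NonUnitalCStarAlgebra A]
    [NormedAddCommGroup X] [NormedSpace ℂ X] [CompleteSpace X] : Type (max u v) where
  smulR : X → A → X
  inner : X → X → A
  smulR_add_left : ∀ x y a, smulR (x + y) a = smulR x a + smulR y a
  smulR_add_right : ∀ x a b, smulR x (a + b) = smulR x a + smulR x b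
  smulR_csmul_left : ∀ (z : ℂ) x a, smulR (z • x) a = z • smulR x a
  smulR_csmul_right : ∀ (z : ℂ) x a, smulR x (z • a) = z • smulR x a
  smulR_mul : ∀ x a b, smulR (smulR x a) b = smulR x (a * b)
  inner_add_right : ∀ x y z, inner x (y + z) = inner x y + inner x z
  inner_csmul_right : ∀ (z : ℂ) x y, inner x (z • y) = z • inner x y
  star_inner : ∀ x y, star (inner x y) = inner y x
  inner_smulR_right : ∀ x y a, inner x (smulR y a) = inner x y * a
  inner_self_nonneg : ∀ x, ∃ a, inner x x = star a * a
  inner_self_eq_zero : ∀ x, inner x x = 0 → x = 0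
  norm_sq_eq_norm_inner_self : ∀ x, ‖x‖ ^ 2 = ‖inner x x‖
  norm_inner_le : ∀ x y, ‖inner x y‖ ≤ ‖x‖ * ‖y‖
  norm_smulR_le : ∀ x a, ‖smulR x a‖ ≤ ‖x‖ * ‖a‖

/-- A C*-correspondence over `A`:  a right Hilbert `A`-module together with a
left action of `A` by adjointable operators, i.e. a *-homomorphism
`λ = lact : A → L(X)`. -/
structure Correspondence (A : Type u) (X : Type v) [NonUnitalCStarAlgebra A]
    [NormedAddCommGroup X] [NormedSpace ℂ X] [CompleteSpace X]
    extends HilbertModule A X where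
  lact : A → X →L[ℂ] X
  lact_add : ∀ a b, lact (a + b) = lact a + lact b
  lact_csmul : ∀ (z : ℂ) a, lact (z • a) = z • lact a
  lact_mul : ∀ a b, lact (a * b) = (lact a).comp (lact b)
  lact_adjoint : ∀ a x y, inner (lact a x) y = inner x (lact (star a) y)
  lact_smulR : ∀ a x b, lact a (smulR x b) = smulR (lact a x) b

namespace HilbertModule

variable {A : Type u} {X : Type v} [NonUnitalCStarAlgebra A]
  [NormedAddCommGroup X] [NormedSpace ℂ X] [CompleteSpace X]

/-- The rank-one operator `θ_{x,y} : z ↦ x·⟨y,z⟩` on a Hilbert module. -/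
def rankOne (M : HilbertModule A X) (x y : X) : X →L[ℂ] X :=
  LinearMap.mkContinuous
    { toFun := fun z => M.smulR x (M.inner y z)
      map_add' := fun z w => by
        show M.smulR x (M.inner y (z + w)) = M.smulR x (M.inner y z) + M.smulR x (M.inner y w)
        rw [M.inner_add_right, M.smulR_add_right]
      map_smul' := fun c z => by
        show M.smulR x (M.inner y (c • z)) = c • M.smulR x (M.inner y z)
        rw [M.inner_csmul_right, M.smulR_csmul_right] }
    (‖x‖ * ‖y‖)
    (fun z => by
      calc ‖M.smulR x (M.inner y z)‖ ≤ ‖x‖ * ‖M.inner y z‖ := M.norm_smulR_le _ _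
        _ ≤ ‖x‖ * (‖y‖ * ‖z‖) :=
            mul_le_mul_of_nonneg_left (M.norm_inner_le y z) (norm_nonneg x)
        _ = ‖x‖ * ‖y‖ * ‖z‖ := (mul_assoc _ _ _).symm)

/-- `K(X)`, the compact operators on the Hilbert module `X`: the closed linear
span of the rank-one operators, viewed as a (closed) subspace of the bounded
operators on `X`. -/
def compacts (M : HilbertModule A X) : Submodule ℂ (X →L[ℂ] X) :=
  (Submodule.span ℂ (Set.range fun p : X × X => M.rankOne p.1 p.2)).topologicalClosure

theorem rankOne_mem_compacts (M : HilbertModule A X) (x y : X) :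
    M.rankOne x y ∈ M.compacts :=
  Submodule.le_topologicalClosure _ (Submodule.subset_span ⟨(x, y), rfl⟩)

end HilbertModule

namespace Correspondence

variable {A : Type u} {X : Type v} [NonUnitalCStarAlgebra A]
  [NormedAddCommGroup X] [NormedSpace ℂ X] [CompleteSpace X]

/-- The Katsura ideal `J_X` of a C*-correspondence: the set of `a ∈ A` such
that `λ(a)` is a compact operator on `X` and `a·b = 0` for every `b` in the
kernel of the left action `λ`. -/
def katsura (c : Correspondence A X) : Set A :=
  {a | c.lact a ∈ c.toHilbertModule.compacts ∧ ∀ b, c.lact b = 0 → a * b = 0}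

/-- The left action of the Katsura ideal on `X` is non-degenerate: the closed
linear span of `{a·x : a ∈ J_X, x ∈ X}` is all of `X`. -/
def KatsuraNondegenerate (c : Correspondence A X) : Prop :=
  (Submodule.span ℂ {z : X | ∃ a ∈ c.katsura, ∃ x : X, z = c.lact a x}).topologicalClosure = ⊤

end Correspondence

/-- A Toeplitz pair `(π⁰, π¹)` from the C*-correspondence `(A, X)` to a
C*-algebra `C`: a *-homomorphism `π⁰ : A → C` and a linear map `π¹ : X → C`
with `π⁰(a)π¹(x) = π¹(a·x)` and `π¹(x)*π¹(y) = π⁰(⟨x,y⟩)`. -/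
structure ToeplitzPair {A : Type u} {X : Type v} [NonUnitalCStarAlgebra A]
    [NormedAddCommGroup X] [NormedSpace ℂ X] [CompleteSpace X]
    (c : Correspondence A X) (C : Type w) [NonUnitalCStarAlgebra C] : Type (max u v w) where
  p0 : A →⋆ₙₐ[ℂ] C
  p1 : X →ₗ[ℂ] C
  p0_mul_p1 : ∀ a x, p0 a * p1 x = p1 (c.lact a x)
  star_p1_mul_p1 : ∀ x y, star (p1 x) * p1 y = p0 (c.toHilbertModule.inner x y)

namespace ToeplitzPair

variable {A : Type u} {X : Type v} [NonUnitalCStarAlgebra A]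
  [NormedAddCommGroup X] [NormedSpace ℂ X] [CompleteSpace X]
  {c : Correspondence A X} {C : Type w} [NonUnitalCStarAlgebra C]

/-- A Toeplitz pair is covariant if `π⁰(a) = φ_π(λ(a))` for all `a ∈ J_X`,
where `φ_π : K(X) → C` is the (unique, automatically *-homomorphic) continuous
linear map with `φ_π(θ_{x,y}) = π¹(x)π¹(y)*`. -/
def IsCovariant (T : ToeplitzPair c C) : Prop :=
  ∃ Φ : (c.toHilbertModule.compacts : Submodule ℂ (X →L[ℂ] X)) →L[ℂ] C,
    (∀ x y : X, Φ ⟨c.toHilbertModule.rankOne x y,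
        c.toHilbertModule.rankOne_mem_compacts x y⟩ = T.p1 x * star (T.p1 y)) ∧
    ∀ a, (ha : a ∈ c.katsura) → T.p0 a = Φ ⟨c.lact a, ha.1⟩

end ToeplitzPair

/-- `O` together with the covariant Toeplitz pair `ι = (ι⁰, ι¹)` is (a copy of)
the Cuntz-Pimsner algebra of the C*-correspondence `(A, X)`: `ι⁰` is injective,
`O` is generated as a C*-algebra by `ι⁰(A) ∪ ι¹(X)`, and every covariant
Toeplitz pair factors through `O`. -/
structure IsCuntzPimsner {A : Type u} {X : Type v} [NonUnitalCStarAlgebra A]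
    [NormedAddCommGroup X] [NormedSpace ℂ X] [CompleteSpace X]
    (c : Correspondence A X) (O : Type w) [NonUnitalCStarAlgebra O]
    (ι : ToeplitzPair c O) : Prop where
  covariant : ι.IsCovariant
  injective : Function.Injective ι.p0
  generates :
    closure ((NonUnitalStarAlgebra.adjoin ℂ (Set.range ι.p0 ∪ Set.range ι.p1) :
      NonUnitalStarSubalgebra ℂ O) : Set O) = Set.univ
  universal : ∀ (C : Type u') [NonUnitalCStarAlgebra C] (T : ToeplitzPair c C),
    T.IsCovariant → ∃ ρ : O →⋆ₙₐ[ℂ] C, (∀ a, ρ (ι.p0 a) = T.p0 a) ∧ ∀ x, ρ (ι.p1 x) = T.p1 x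

/-- The operator space `S(A,X)`: the closed linear span of
`ι⁰(A) ∪ ι¹(X) ∪ ι¹(X)*` inside the Cuntz-Pimsner algebra. -/
def SAX {A : Type u} {X : Type v} [NonUnitalCStarAlgebra A]
    [NormedAddCommGroup X] [NormedSpace ℂ X] [CompleteSpace X]
    {c : Correspondence A X} {O : Type w} [NonUnitalCStarAlgebra O]
    (ι : ToeplitzPair c O) : Set O :=
  closure ((Submodule.span ℂ (Set.range ι.p0 ∪ Set.range ι.p1 ∪ star '' Set.range ι.p1) :
    Submodule ℂ O) : Set O)

/-- `φ : C → B(H)` is a completely positive and completely contractive linear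
map.  Complete positivity is recorded through the standard characterization:
for all `n`, `a : Fin n → C` and `h : Fin n → H` one has
`0 ≤ ∑_{i,j} ⟪h i, φ(a i * a j)(h j)⟫` (every positive matrix over `C` is a sum
of Gram matrices `(a_i* a_j)_{ij}`, and positivity of a matrix of operators is
tested against vectors, so this is exactly positivity of all amplifications).
For completely positive maps the completely bounded norm coincides with the
norm, so complete contractivity is recorded as contractivity. -/
structure IsCPCMap {C : Type w} [NonUnitalCStarAlgebra C] {H : Type u'}
    [NormedAddCommGroup H] [InnerProductSpace ℂ H] [CompleteSpace H]
    (φ : C → H →L[ℂ] H) : Prop where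
  map_add : ∀ x y, φ (x + y) = φ x + φ y
  map_smul : ∀ (z : ℂ) x, φ (z • x) = z • φ x
  completely_positive : ∀ (n : ℕ) (a : Fin n → C) (h : Fin n → H),
    0 ≤ ∑ i, ∑ j, ⟪h i, φ (star (a i) * a j) (h j)⟫_ℂ
  contractive : ∀ x, ‖φ x‖ ≤ ‖x‖

/-- Hyperrigidity of a C*-correspondence `(A,X)` (with Cuntz-Pimsner algebra
`O` and canonical covariant pair `ι`): for every Hilbert space `H`, every
*-homomorphism `π : O → B(H)` and every completely positive completely
contractive map `φ : O → B(H)` agreeing with `π` on `S(A,X)`, one has `φ = π`. -/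
def Hyperrigid {A : Type u} {X : Type v} [NonUnitalCStarAlgebra A]
    [NormedAddCommGroup X] [NormedSpace ℂ X] [CompleteSpace X]
    (c : Correspondence A X) (O : Type w) [NonUnitalCStarAlgebra O]
    (ι : ToeplitzPair c O) : Prop :=
  ∀ (H : Type u') [NormedAddCommGroup H] [InnerProductSpace ℂ H] [CompleteSpace H]
    (π : O →⋆ₙₐ[ℂ] (H →L[ℂ] H)) (φ : O → H →L[ℂ] H),
    IsCPCMap φ → (∀ s ∈ SAX ι, φ s = π s) → ∀ w : O, φ w = π w

theorem NonUnitalStarAlgHom.continuous_of_cstar {A B : Type*} [NonUnitalCStarAlgebra A]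
    [NonUnitalCStarAlgebra B] (π : A →⋆ₙₐ[ℂ] B) : Continuous π :=
  AddMonoidHomClass.continuous_of_bound π 1 fun x => by
    rw [one_mul]
    exact norm_apply_le π x

namespace IsCPCMap

variable {C : Type*} [NonUnitalCStarAlgebra C] {H : Type*} [NormedAddCommGroup H]
  [InnerProductSpace ℂ H] [CompleteSpace H] {φ : C → H →L[ℂ] H}

theorem map_zero (hφ : IsCPCMap φ) : φ 0 = 0 := by
  simpa using hφ.map_smul 0 0

theorem map_sub (hφ : IsCPCMap φ) (x y : C) : φ (x - y) = φ x - φ y := by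
  have h := hφ.map_add (x - y) y
  rw [sub_add_cancel] at h
  rw [h, add_sub_cancel_right]

theorem continuous (hφ : IsCPCMap φ) : Continuous φ := by
  refine (LipschitzWith.of_dist_le_mul (K := 1) fun x y => ?_).continuous
  rw [dist_eq_norm, dist_eq_norm, ← hφ.map_sub, NNReal.coe_one, one_mul]
  exact hφ.contractive _

/-- Positivity of the `3 × 3` amplification of `φ` at the Gram matrix of `(1, s, b)`, where the
unit of the (possibly non-unital) algebra is approximated. -/
theorem gram_nonneg (hφ : IsCPCMap φ) (s b : C) (k h g : H) :
    0 ≤ ⟪k, k⟫_ℂ + ⟪k, φ s h⟫_ℂ + ⟪k, φ b g⟫_ℂ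
      + (⟪h, φ (star s) k⟫_ℂ + ⟪h, φ (star s * s) h⟫_ℂ + ⟪h, φ (star s * b) g⟫_ℂ)
      + (⟪g, φ (star b) k⟫_ℂ + ⟪g, φ (star b * s) h⟫_ℂ + ⟪g, φ (star b * b) g⟫_ℂ) := by
  let : PartialOrder C := CStarAlgebra.spectralOrder C
  have : StarOrderedRing C := CStarAlgebra.spectralOrderedRing C
  have hl := CStarAlgebra.increasingApproximateUnit C
  have hcont := hφ.continuous
  have tr (z : C) (p q : H) : Tendsto (fun e => ⟪p, φ (e * z) q⟫_ℂ)
      (CStarAlgebra.approximateUnit C) (𝓝 ⟪p, φ z q⟫_ℂ) :=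
    ((by fun_prop : Continuous fun y => ⟪p, φ y q⟫_ℂ).tendsto z).comp (hl.tendsto_mul_right z)
  have tl (z : C) (p q : H) : Tendsto (fun e => ⟪p, φ (z * e) q⟫_ℂ)
      (CStarAlgebra.approximateUnit C) (𝓝 ⟪p, φ z q⟫_ℂ) :=
    ((by fun_prop : Continuous fun y => ⟪p, φ y q⟫_ℂ).tendsto z).comp (hl.tendsto_mul_left z)
  have lim := ((((tr s k h).const_add ⟪k, k⟫_ℂ).add (tr b k g)).add
    (((tl (star s) h k).add_const ⟪h, φ (star s * s) h⟫_ℂ).add_const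
      ⟪h, φ (star s * b) g⟫_ℂ)).add
    (((tl (star b) g k).add_const ⟪g, φ (star b * s) h⟫_ℂ).add_const ⟪g, φ (star b * b) g⟫_ℂ)
  refine ge_of_tendsto lim ?_
  filter_upwards [hl.eventually_star_eq, hl.eventually_norm] with e he hnorm
  have h1 : 0 ≤ ⟪k, φ (e * e) k⟫_ℂ := by
    simpa [he] using hφ.completely_positive 1 ![e] ![k]
  have h2 : ⟪k, φ (e * e) k⟫_ℂ ≤ ⟪k, k⟫_ℂ := by
    rw [Complex.eq_coe_norm_of_nonneg h1, inner_self_eq_norm_sq_to_K]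
    have h3 : ‖φ (e * e)‖ ≤ 1 := (hφ.contractive _).trans
      ((norm_mul_le _ _).trans (mul_le_one₀ hnorm (norm_nonneg _) hnorm))
    have h4 : ‖⟪k, φ (e * e) k⟫_ℂ‖ ≤ ‖k‖ ^ 2 := calc
      _ ≤ ‖k‖ * ‖φ (e * e) k‖ := norm_inner_le_norm _ _
      _ ≤ ‖k‖ * (1 * ‖k‖) := by
        gcongr
        exact (φ (e * e)).le_of_opNorm_le h3 k
      _ = ‖k‖ ^ 2 := by ring
    exact (Complex.real_le_real.2 h4).trans_eq (by simp)
  have h5 := hφ.completely_positive 3 ![e, s, b] ![k, h, g]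
  simp only [Fin.sum_univ_three, Matrix.cons_val, he] at h5
  refine h5.trans ?_
  gcongr

theorem map_star (hφ : IsCPCMap φ) (s : C) : φ (star s) = star (φ s) := by
  have him (k h : H) : (⟪k, φ s h⟫_ℂ + ⟪h, φ (star s) k⟫_ℂ).im = 0 := by
    have h1 := (Complex.nonneg_iff.1 (hφ.gram_nonneg s 0 k h 0)).2
    have h2 : 0 ≤ ⟪h, φ (star s * s) h⟫_ℂ := by
      simpa using hφ.completely_positive 1 ![s] ![h]
    have h3 := (Complex.nonneg_iff.1 h2).2
    have h4 : (⟪k, k⟫_ℂ).im = 0 := inner_self_im (𝕜 := ℂ) k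
    simp only [inner_zero_left, ContinuousLinearMap.map_zero, inner_zero_right, add_zero,
      Complex.add_im] at h1 ⊢
    linarith
  refine ContinuousLinearMap.ext fun k => ext_inner_left ℂ fun h => ?_
  rw [ContinuousLinearMap.star_eq_adjoint, ContinuousLinearMap.adjoint_inner_right]
  have h1 := him k h
  have h2 := him (Complex.I • k) h
  simp only [inner_smul_left, ContinuousLinearMap.map_smul, inner_smul_right, Complex.conj_I,
    Complex.add_im, Complex.mul_im, Complex.neg_re, Complex.neg_im, Complex.I_re,
    Complex.I_im] at h1 h2
  rw [← inner_conj_symm (φ s h) k]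
  refine Complex.ext ?_ ?_
  · rw [Complex.conj_re]
    linarith
  · rw [Complex.conj_im]
    linarith

/-- Elements `s` at which the Schwarz inequality `φ(s)*φ(s) ≤ φ(s*s)` is an equality lie in the
(right) multiplicative domain of `φ`. -/
theorem map_mul_of_map_star_mul_self (hφ : IsCPCMap φ) {s : C}
    (hs : φ (star s * s) = star (φ s) * φ s) (b : C) : φ (b * s) = φ b * φ s := by
  refine ContinuousLinearMap.ext fun h => ext_inner_left ℂ fun g => ?_
  set α := ⟪g, φ (b * s) h⟫_ℂ - ⟪g, (φ b * φ s) h⟫_ℂ with hα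
  set β := ⟪h, φ (star s * star b) g⟫_ℂ - ⟪h, (star (φ s) * star (φ b)) g⟫_ℂ with hβ
  set γ := ⟪g, φ (b * star b) g⟫_ℂ - ⟪g, (φ b * star (φ b)) g⟫_ℂ with hγ
  have key (t : ℂ) : 0 ≤ t * α + starRingEnd ℂ t * β + γ := by
    refine (hφ.gram_nonneg s (star b) (-(φ s (t • h) + φ (star b) g)) (t • h) g).trans_eq ?_
    rw [hα, hβ, hγ, hs, star_star, hφ.map_star, hφ.map_star]
    simp only [ContinuousLinearMap.star_eq_adjoint, mul_apply_eq_comp,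
      ContinuousLinearMap.adjoint_inner_right, inner_neg_left, inner_neg_right, inner_add_left,
      inner_add_right, map_neg, ContinuousLinearMap.map_add,
      ContinuousLinearMap.map_smul, inner_smul_left, inner_smul_right]
    simp only [← ContinuousLinearMap.adjoint_inner_left (φ b)]
    ring
  have hre (t : ℂ) := (Complex.nonneg_iff.1 (key t)).1
  have him (t : ℂ) := (Complex.nonneg_iff.1 (key t)).2
  rw [← sub_eq_zero, ← hα]
  clear_value α β γ
  obtain ⟨hγ0, hγ1⟩ := Complex.nonneg_iff.1 (by simpa using key 0 : 0 ≤ γ)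
  have e1 : α.im + β.im = 0 := by
    have := him 1
    simp at this
    linarith
  have e2 : α.re - β.re = 0 := by
    have := him Complex.I
    simp at this
    linarith
  have aux (x : ℝ) (hx : ∀ r : ℝ, 0 ≤ r * x + γ.re) : x = 0 := by
    by_contra hne
    have := hx (-(γ.re + 1) / x)
    rw [div_mul_cancel₀ _ hne] at this
    linarith
  have e3 : α.re + β.re = 0 := aux _ fun r => by
    have := hre r
    simp at this
    linarith
  have e4 : -α.im + β.im = 0 := aux _ fun r => by
    have := hre (r * Complex.I)
    simp at this
    linarith
  refine Complex.ext ?_ ?_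
  · rw [Complex.zero_re]
    linarith
  · rw [Complex.zero_im]
    linarith

end IsCPCMap

namespace ToeplitzPair

variable {A : Type*} {X : Type*} [NonUnitalCStarAlgebra A]
  [NormedAddCommGroup X] [NormedSpace ℂ X] [CompleteSpace X]
  {c : Correspondence A X} {C : Type*} [NonUnitalCStarAlgebra C]

theorem norm_p1_le (T : ToeplitzPair c C) (x : X) : ‖T.p1 x‖ ≤ ‖x‖ := by
  refine le_of_sq_le_sq ?_ (norm_nonneg x)
  rw [sq ‖T.p1 x‖, ← CStarRing.norm_star_mul_self, T.star_p1_mul_p1, c.norm_sq_eq_norm_inner_self]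
  exact NonUnitalStarAlgHom.norm_apply_le T.p0 _

theorem continuous_p1 (T : ToeplitzPair c C) : Continuous T.p1 :=
  AddMonoidHomClass.continuous_of_bound T.p1 1 fun x => by
    rw [one_mul]
    exact T.norm_p1_le x

variable {H : Type*} [NormedAddCommGroup H] [InnerProductSpace ℂ H] [CompleteSpace H]
  {φ : C → H →L[ℂ] H} {π : C →⋆ₙₐ[ℂ] (H →L[ℂ] H)}

/-- If `φ` is right multiplicative over `π` on `ι⁰(A)` and `ι¹(X)`, then by covariance it is so on
`ι¹(a·x)*` for `a` in the Katsura ideal. -/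
theorem map_mul_star_p1_lact {T : ToeplitzPair c C} (hT : T.IsCovariant)
    (h0 : ∀ b a, φ (b * T.p0 a) = φ b * π (T.p0 a))
    (h1 : ∀ b x, φ (b * T.p1 x) = φ b * π (T.p1 x))
    {a : A} (ha : a ∈ c.katsura) (x : X) (b : C) :
    φ (b * star (T.p1 (c.lact a x))) = φ b * π (star (T.p1 (c.lact a x))) := by
  obtain ⟨Φ, hΦ, hΦa⟩ := hT
  have hπ : Continuous π := π.continuous_of_cstar
  have key : ∀ k : c.toHilbertModule.compacts,
      φ (b * star (T.p1 x)) * star (π (Φ k)) = φ b * (π (star (T.p1 x)) * star (π (Φ k))) := by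
    rintro ⟨k, hk⟩
    let p : c.toHilbertModule.compacts → Prop := fun k =>
      φ (b * star (T.p1 x)) * star (π (Φ k)) = φ b * (π (star (T.p1 x)) * star (π (Φ k)))
    have hclosed : IsClosed {k | p k} := isClosed_eq (by fun_prop) (by fun_prop)
    have hspan (k : X →L[ℂ] X) (hk : k ∈ Submodule.span ℂ
        (Set.range fun q : X × X => c.toHilbertModule.rankOne q.1 q.2)) :
        p ⟨k, Submodule.le_topologicalClosure _ hk⟩ := by
      induction hk using Submodule.span_induction with
      | mem k hk =>
        obtain ⟨⟨y, z⟩, rfl⟩ := hk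
        simp only [p, hΦ]
        rw [map_mul, star_mul, ← map_star π, star_star, ← mul_assoc, ← h1, mul_assoc b,
          T.star_p1_mul_p1, h0, ← T.star_p1_mul_p1, map_mul]
        simp only [mul_assoc, map_star]
      | zero =>
        have : (⟨0, Submodule.le_topologicalClosure _ (zero_mem _)⟩ :
          c.toHilbertModule.compacts) = 0 := rfl
        simp [p, this]
      | add k l hk hl ihk ihl =>
        have : (⟨k + l, Submodule.le_topologicalClosure _ (add_mem hk hl)⟩ :
          c.toHilbertModule.compacts) = ⟨k, Submodule.le_topologicalClosure _ hk⟩ +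
            ⟨l, Submodule.le_topologicalClosure _ hl⟩ := rfl
        simp only [p, this, map_add, star_add, mul_add] at ihk ihl ⊢
        rw [ihk, ihl]
      | smul r k hk ihk =>
        have : (⟨r • k, Submodule.le_topologicalClosure _ (Submodule.smul_mem _ r hk)⟩ :
          c.toHilbertModule.compacts) = r • ⟨k, Submodule.le_topologicalClosure _ hk⟩ := rfl
        simp only [p, this, map_smul, star_smul, mul_smul_comm] at ihk ⊢
        rw [ihk]
    have hdense : closure {k : c.toHilbertModule.compacts | (k : X →L[ℂ] X) ∈ Submodule.span ℂ
        (Set.range fun q : X × X => c.toHilbertModule.rankOne q.1 q.2)} ⊆ {k | p k} :=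
      closure_minimal (fun k hk => hspan k.1 hk) hclosed
    refine hdense (closure_subtype.2 ?_)
    have : k ∈ closure (Submodule.span ℂ
        (Set.range fun q : X × X => c.toHilbertModule.rankOne q.1 q.2) : Set (X →L[ℂ] X)) := hk
    refine closure_mono (fun l hl => ?_) this
    exact ⟨⟨l, Submodule.le_topologicalClosure _ hl⟩, hl, rfl⟩
  rw [← T.p0_mul_p1, star_mul, ← mul_assoc, ← map_star T.p0, h0, map_star T.p0, map_mul,
    map_star π (T.p0 a), hΦa a ha]
  exact key _

end ToeplitzPair

/-- If the left action of the Katsura ideal `J_X` of a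
C*-correspondence `(A, X)` on `X` is non-degenerate (the closed linear span of
`{a·x : a ∈ J_X, x ∈ X}` is all of `X`), then `(A, X)` is hyperrigid. -/
theorem hyperrigid_of_katsuraNondegenerate
    {A : Type u} {X : Type v} [NonUnitalCStarAlgebra A] [NormedAddCommGroup X]
    [NormedSpace ℂ X] [CompleteSpace X] (c : Correspondence A X)
    (O : Type w) [NonUnitalCStarAlgebra O] (ι : ToeplitzPair c O)
    (hO : IsCuntzPimsner c O ι) (hnd : c.KatsuraNondegenerate) :
    Hyperrigid c O ι := by
  intro H _ _ _ π φ hφ hS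
  have hφc := hφ.continuous
  have hπc : Continuous π := π.continuous_of_cstar
  have hS0 (a : A) : φ (ι.p0 a) = π (ι.p0 a) :=
    hS _ (subset_closure (Submodule.subset_span (Or.inl (Or.inl ⟨a, rfl⟩))))
  have hS1 (x : X) : φ (ι.p1 x) = π (ι.p1 x) :=
    hS _ (subset_closure (Submodule.subset_span (Or.inl (Or.inr ⟨x, rfl⟩))))
  have h0 (b : O) (a : A) : φ (b * ι.p0 a) = φ b * π (ι.p0 a) := by
    rw [← hS0]
    apply hφ.map_mul_of_map_star_mul_self
    rw [← map_star ι.p0, ← map_mul, hS0, hS0, map_mul, map_mul, map_star, map_star]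
  have h1 (b : O) (x : X) : φ (b * ι.p1 x) = φ b * π (ι.p1 x) := by
    rw [← hS1]
    apply hφ.map_mul_of_map_star_mul_self
    rw [ι.star_p1_mul_p1, hS0, hS1, ← ι.star_p1_mul_p1, map_mul, map_star]
  have h2 (x : X) (b : O) : φ (b * star (ι.p1 x)) = φ b * π (star (ι.p1 x)) := by
    have hι := ι.continuous_p1
    have hx : x ∈ closure (Submodule.span ℂ
        {z : X | ∃ a ∈ c.katsura, ∃ x : X, z = c.lact a x} : Set X) := by
      have : x ∈ (Submodule.span ℂ
        {z : X | ∃ a ∈ c.katsura, ∃ x : X, z = c.lact a x}).topologicalClosure := by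
        rw [hnd]
        trivial
      exact this
    refine closure_minimal (t := {x | φ (b * star (ι.p1 x)) = φ b * π (star (ι.p1 x))})
      (fun y hy => ?_) (isClosed_eq (by fun_prop) (by fun_prop)) hx
    rw [Set.mem_ofPred_eq]
    induction hy using Submodule.span_induction with
    | mem y hy =>
      obtain ⟨a, ha, x, rfl⟩ := hy
      exact ι.map_mul_star_p1_lact hO.covariant h0 h1 ha x b
    | zero => simp [hφ.map_zero]
    | add y z _ _ ihy ihz => simp only [map_add, star_add, mul_add, hφ.map_add, ihy, ihz]
    | smul r y _ ihy =>
      simp only [map_smul, star_smul, mul_smul_comm, hφ.map_smul, ihy]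
  have hgen (w : O) (hw : w ∈ NonUnitalStarAlgebra.adjoin ℂ (Set.range ι.p0 ∪ Set.range ι.p1)) :
      φ w = π w ∧ (∀ b, φ (b * w) = φ b * π w) ∧ ∀ b, φ (b * star w) = φ b * π (star w) := by
    induction hw using NonUnitalStarAlgebra.adjoin_induction with
    | mem w hw =>
      rcases hw with ⟨a, rfl⟩ | ⟨x, rfl⟩
      · exact ⟨hS0 a, fun b => h0 b a, fun b => by rw [← map_star ι.p0, h0]⟩
      · exact ⟨hS1 x, fun b => h1 b x, h2 x⟩
    | add y z _ _ ihy ihz =>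
      refine ⟨?_, fun b => ?_, fun b => ?_⟩
      · rw [hφ.map_add, ihy.1, ihz.1, map_add]
      · rw [mul_add, hφ.map_add, ihy.2.1, ihz.2.1, map_add, mul_add]
      · rw [star_add, mul_add, hφ.map_add, ihy.2.2, ihz.2.2, map_add, mul_add]
    | zero => simp [hφ.map_zero]
    | mul y z _ _ ihy ihz =>
      refine ⟨?_, fun b => ?_, fun b => ?_⟩
      · rw [ihz.2.1, ihy.1, map_mul]
      · rw [← mul_assoc, ihz.2.1, ihy.2.1, map_mul, mul_assoc]
      · rw [star_mul, ← mul_assoc, ihy.2.2, ihz.2.2, map_mul, mul_assoc]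
    | smul r y _ ihy =>
      refine ⟨?_, fun b => ?_, fun b => ?_⟩
      · rw [hφ.map_smul, ihy.1, map_smul]
      · rw [mul_smul_comm, hφ.map_smul, ihy.2.1, map_smul, mul_smul_comm]
      · rw [star_smul, mul_smul_comm, hφ.map_smul, ihy.2.2, map_smul, mul_smul_comm]
    | star y _ ihy =>
      refine ⟨?_, ihy.2.2, fun b => ?_⟩
      · rw [hφ.map_star, ihy.1, map_star]
      · rw [star_star, ihy.2.1]
  intro w
  have hw : w ∈ closure ((NonUnitalStarAlgebra.adjoin ℂ (Set.range ι.p0 ∪ Set.range ι.p1) :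
      NonUnitalStarSubalgebra ℂ O) : Set O) := by
    rw [hO.generates]
    trivial
  exact closure_minimal (t := {w | φ w = π w}) (fun w hw => (hgen w hw).1)
    (isClosed_eq hφc hπc) hw

end
end

section
/- Let A be a C*-algebra and X a right Hilbert A-module. For a countably generated closed A-submodule Y of X with standard normalized frame (x_j(Y))_{j≥1} and n ∈ ℕ, let e_n(Y) denote the map Y → Y, z ↦ Σ_{j=1}^{n} x_j(Y)·⟨x_j(Y),z⟩. Then the family (e_n(Y)) is an approximate unit for K(X) in the following sense: for every T ∈ K(X) and every ε > 0 there exist finitely many y_1,…,y_m, z_1,…,z_m ∈ X such that, setting S := Σ_{k=1}^{m} θ_{y_k,z_k}, one has ‖T − S‖ < ε, and for every countably generated closed A-submodule Y of X containing y_1,…,y_m (with any standard normalized frame (x_j(Y))), the operators e_n(Y)∘S (well defined since S has range in Y) satisfy lim_{n→∞} ‖e_n(Y)∘S − S‖ = 0; in particular ‖e_n(Y)∘S − T‖ < 3ε for all sufficiently large n. -/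
/-!
Common framework: Hilbert C*-modules, C*-correspondences, compact operators,
the Katsura ideal, Toeplitz pairs, covariance, Cuntz-Pimsner algebras,
completely positive completely contractive maps, and hyperrigidity.
-/

noncomputable section

open Filter Topology Set
open scoped ComplexOrder InnerProductSpace

universe u v w u'

/-- An element of the multiplier module `M(Y) = L(A, Y)` of a submodule
`Y ⊆ X`: an adjointable operator from `A` (viewed as a Hilbert `A`-module over
itself) to `Y ⊆ X`.  `toFun a` is the value `x·a ∈ Y` and `adj z = ⟨x, z⟩ ∈ A`
is the adjoint, so that `⟨x·a, z⟩ = a* * ⟨x, z⟩` (adjointable operators are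
automatically bounded and linear; we record these facts as fields). -/
structure Multiplier {A : Type u} {X : Type v} [NonUnitalCStarAlgebra A]
    [NormedAddCommGroup X] [NormedSpace ℂ X] [CompleteSpace X]
    (M : HilbertModule A X) (Y : Submodule ℂ X) : Type (max u v) where
  toFun : A → X
  adj : X → A
  mem_toFun : ∀ a, toFun a ∈ Y
  toFun_add : ∀ a b, toFun (a + b) = toFun a + toFun b
  toFun_csmul : ∀ (z : ℂ) a, toFun (z • a) = z • toFun a
  toFun_mul : ∀ a b, toFun (a * b) = M.smulR (toFun a) b
  adj_add : ∀ x y, adj (x + y) = adj x + adj y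
  adj_csmul : ∀ (z : ℂ) x, adj (z • x) = z • adj x
  adjoint : ∀ a x, M.inner (toFun a) x = star a * adj x
  continuous_toFun : Continuous toFun
  continuous_adj : Continuous adj

/-- `Y` is a closed right-`A`-submodule of the Hilbert module `X`. -/
structure IsClosedSubmodule {A : Type u} {X : Type v} [NonUnitalCStarAlgebra A]
    [NormedAddCommGroup X] [NormedSpace ℂ X] [CompleteSpace X]
    (M : HilbertModule A X) (Y : Submodule ℂ X) : Prop where
  isClosed : IsClosed (Y : Set X)
  smulR_mem : ∀ x ∈ Y, ∀ a, M.smulR x a ∈ Y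

/-- `Y` is countably generated over `A`: there is a sequence in `M(Y)` whose
`A`-linear span is dense in `Y`. -/
def IsCountablyGenerated {A : Type u} {X : Type v} [NonUnitalCStarAlgebra A]
    [NormedAddCommGroup X] [NormedSpace ℂ X] [CompleteSpace X]
    (M : HilbertModule A X) (Y : Submodule ℂ X) : Prop :=
  ∃ xs : ℕ → Multiplier M Y,
    (Y : Set X) ⊆
      closure ((Submodule.span ℂ {w : X | ∃ n a, w = (xs n).toFun a} : Submodule ℂ X) : Set X)

/-- `(xs n)` is a standard normalized frame for `Y`: for every `y ∈ Y` the
reconstruction formula `y = ∑_{n ≥ 1} x_n·⟨x_n, y⟩` holds. -/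
def IsFrame {A : Type u} {X : Type v} [NonUnitalCStarAlgebra A]
    [NormedAddCommGroup X] [NormedSpace ℂ X] [CompleteSpace X]
    (M : HilbertModule A X) (Y : Submodule ℂ X) (xs : ℕ → Multiplier M Y) : Prop :=
  ∀ y ∈ Y, Tendsto (fun n => ∑ j ∈ Finset.range n, (xs j).toFun ((xs j).adj y))
    atTop (𝓝 y)

/-- The operator `e_n(Y) ∘ S : z ↦ ∑_{j<n} x_j(Y)·⟨x_j(Y), S z⟩` associated to a
sequence `xs` in `M(Y)` and an operator `S` on `X`. -/
def frameApprox {A : Type u} {X : Type v} [NonUnitalCStarAlgebra A]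
    [NormedAddCommGroup X] [NormedSpace ℂ X] [CompleteSpace X]
    (M : HilbertModule A X) {Y : Submodule ℂ X} (xs : ℕ → Multiplier M Y) (n : ℕ)
    (S : X →L[ℂ] X) : X →L[ℂ] X :=
  { toLinearMap :=
    { toFun := fun v => ∑ j ∈ Finset.range n, (xs j).toFun ((xs j).adj (S v))
      map_add' := fun v w => by
        rw [← Finset.sum_add_distrib]
        refine Finset.sum_congr rfl fun j _ => ?_
        rw [map_add, (xs j).adj_add, (xs j).toFun_add]
      map_smul' := fun z v => by
        show (∑ j ∈ Finset.range n, (xs j).toFun ((xs j).adj (S (z • v))))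
          = z • ∑ j ∈ Finset.range n, (xs j).toFun ((xs j).adj (S v))
        rw [Finset.smul_sum]
        exact Finset.sum_congr rfl fun j _ => by
          rw [map_smul, (xs j).adj_csmul, (xs j).toFun_csmul] }
    cont := by
      show Continuous fun v : X => ∑ j ∈ Finset.range n, (xs j).toFun ((xs j).adj (S v))
      refine continuous_finset_sum _ fun j _ => ?_
      exact (xs j).continuous_toFun.comp ((xs j).continuous_adj.comp S.continuous) }

namespace HilbertModule

variable {A : Type u} {X : Type v} [NonUnitalCStarAlgebra A]
  [NormedAddCommGroup X] [NormedSpace ℂ X] [CompleteSpace X]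

theorem smulR_sub_left (M : HilbertModule A X) (x y : X) (a : A) :
    M.smulR (x - y) a = M.smulR x a - M.smulR y a :=
  eq_sub_of_add_eq (by rw [← M.smulR_add_left, sub_add_cancel])

theorem smulR_sum_left (M : HilbertModule A X) {ι : Type*} (s : Finset ι) (x : ι → X) (a : A) :
    M.smulR (∑ i ∈ s, x i) a = ∑ i ∈ s, M.smulR (x i) a :=
  map_sum (AddMonoidHom.mk' (fun w => M.smulR w a) fun v w => M.smulR_add_left v w a) x s

theorem rankOne_apply (M : HilbertModule A X) (x y z : X) :
    M.rankOne x y z = M.smulR x (M.inner y z) := rfl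

theorem norm_rankOne_le (M : HilbertModule A X) (x y : X) : ‖M.rankOne x y‖ ≤ ‖x‖ * ‖y‖ :=
  LinearMap.mkContinuous_norm_le _ (by positivity) _

theorem rankOne_sub_left (M : HilbertModule A X) (x y z : X) :
    M.rankOne (x - y) z = M.rankOne x z - M.rankOne y z := by
  ext v
  simp [rankOne_apply, smulR_sub_left]

theorem rankOne_smul_left (M : HilbertModule A X) (c : ℂ) (x y : X) :
    M.rankOne (c • x) y = c • M.rankOne x y := by
  ext v
  simp [rankOne_apply, M.smulR_csmul_left]

/-- Every compact operator is a norm limit of finite sums of rank-one operators. -/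
theorem exists_norm_sub_sum_rankOne_lt (M : HilbertModule A X) {T : X →L[ℂ] X}
    (hT : T ∈ M.compacts) {ε : ℝ} (hε : 0 < ε) :
    ∃ (m : ℕ) (y z : Fin m → X), ‖T - ∑ k, M.rankOne (y k) (z k)‖ < ε := by
  obtain ⟨S, hS, hTS⟩ := Metric.mem_closure_iff.1 hT ε hε
  obtain ⟨m, c, g, rfl⟩ := Submodule.mem_span_set'.1 hS
  choose p hp using fun k => (g k).2
  refine ⟨m, fun k => c k • (p k).1, fun k => (p k).2, ?_⟩
  rw [dist_eq_norm] at hTS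
  simpa only [rankOne_smul_left, hp] using hTS

end HilbertModule

section FrameApprox

variable {A : Type u} {X : Type v} [NonUnitalCStarAlgebra A]
  [NormedAddCommGroup X] [NormedSpace ℂ X] [CompleteSpace X]
  {M : HilbertModule A X} {Y : Submodule ℂ X}

theorem Multiplier.adj_smulR (x : Multiplier M Y) (y : X) (a : A) :
    x.adj (M.smulR y a) = x.adj y * a := by
  have h (b : A) : star b * (x.adj (M.smulR y a) - x.adj y * a) = 0 := by
    rw [mul_sub, ← x.adjoint, M.inner_smulR_right, x.adjoint, mul_assoc, sub_self]
  exact sub_eq_zero.1 (CStarRing.star_mul_self_eq_zero_iff _ |>.1 (h _))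

theorem frameApprox_sum_rankOne (xs : ℕ → Multiplier M Y) (n : ℕ) {m : ℕ} (y z : Fin m → X) :
    frameApprox M xs n (∑ k, M.rankOne (y k) (z k)) =
      ∑ k, M.rankOne (∑ j ∈ Finset.range n, (xs j).toFun ((xs j).adj (y k))) (z k) := by
  have h_sum (x : Multiplier M Y) (w : Fin m → X) :
      x.toFun (x.adj (∑ k, w k)) = ∑ k, x.toFun (x.adj (w k)) :=
    map_sum (AddMonoidHom.mk' (fun v => x.toFun (x.adj v))
      fun v w => by rw [x.adj_add, x.toFun_add]) w Finset.univ
  ext v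
  change ∑ j ∈ Finset.range n,
    (xs j).toFun ((xs j).adj ((∑ k, M.rankOne (y k) (z k)) v)) = _
  simp only [_root_.sum_apply, h_sum, HilbertModule.rankOne_apply,
    Multiplier.adj_smulR, Multiplier.toFun_mul, HilbertModule.smulR_sum_left]
  exact Finset.sum_comm

theorem IsFrame.tendsto_norm_frameApprox_sub {xs : ℕ → Multiplier M Y} (hxs : IsFrame M Y xs)
    {m : ℕ} {y : Fin m → X} (z : Fin m → X) (hy : ∀ k, y k ∈ Y) :
    Tendsto (fun n => ‖frameApprox M xs n (∑ k, M.rankOne (y k) (z k))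
      - ∑ k, M.rankOne (y k) (z k)‖) atTop (𝓝 0) := by
  have h_lim : Tendsto (fun n => ∑ k,
      ‖∑ j ∈ Finset.range n, (xs j).toFun ((xs j).adj (y k)) - y k‖ * ‖z k‖) atTop (𝓝 0) := by
    rw [← Finset.sum_const_zero (s := (Finset.univ : Finset (Fin m)))]
    refine tendsto_finsetSum _ fun k _ => ?_
    simpa using (tendsto_iff_norm_sub_tendsto_zero.1 (hxs (y k) (hy k))).mul_const ‖z k‖
  refine squeeze_zero (fun n => norm_nonneg _) (fun n => ?_) h_lim
  rw [frameApprox_sum_rankOne, ← Finset.sum_sub_distrib]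
  refine norm_sum_le_of_le _ fun k _ => ?_
  rw [← M.rankOne_sub_left]
  exact M.norm_rankOne_le _ _

end FrameApprox

/-- The operators `e_n(Y)` built from standard normalized
frames of countably generated closed submodules `Y ⊆ X` form an approximate
unit for `K(X)`: for every `T ∈ K(X)` and `ε > 0` there is a finite-rank
operator `S = ∑_k θ_{y_k, z_k}` with `‖T - S‖ < ε` such that for every
countably generated closed `A`-submodule `Y` containing the `y_k`, and every
standard normalized frame `xs` of `Y`, one has `‖e_n(Y)∘S - S‖ → 0`; in
particular `‖e_n(Y)∘S - T‖ < 3ε` for all large `n`. -/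
theorem frameApprox_approximate_unit_of_compacts
    {A : Type u} {X : Type v} [NonUnitalCStarAlgebra A] [NormedAddCommGroup X]
    [NormedSpace ℂ X] [CompleteSpace X] (M : HilbertModule A X)
    (T : X →L[ℂ] X) (hT : T ∈ M.compacts) {ε : ℝ} (hε : 0 < ε) :
    ∃ (m : ℕ) (y z : Fin m → X),
      ‖T - ∑ k, M.rankOne (y k) (z k)‖ < ε ∧
      ∀ Y : Submodule ℂ X, IsClosedSubmodule M Y → IsCountablyGenerated M Y →
        (∀ k, y k ∈ Y) → ∀ xs : ℕ → Multiplier M Y, IsFrame M Y xs →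
          Tendsto (fun n => ‖frameApprox M xs n (∑ k, M.rankOne (y k) (z k))
              - ∑ k, M.rankOne (y k) (z k)‖) atTop (𝓝 0) ∧
          ∀ᶠ n in atTop,
            ‖frameApprox M xs n (∑ k, M.rankOne (y k) (z k)) - T‖ < 3 * ε := by
  obtain ⟨m, y, z, hS⟩ := M.exists_norm_sub_sum_rankOne_lt hT hε
  refine ⟨m, y, z, hS, fun Y _ _ hy xs hxs => ?_⟩
  have h_lim := hxs.tendsto_norm_frameApprox_sub z hy
  refine ⟨h_lim, ?_⟩
  filter_upwards [h_lim.eventually_lt_const hε] with n hn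
  have h_tri := norm_sub_le_norm_sub_add_norm_sub
    (frameApprox M xs n (∑ k, M.rankOne (y k) (z k))) (∑ k, M.rankOne (y k) (z k)) T
  rw [norm_sub_rev (∑ k, M.rankOne (y k) (z k)) T] at h_tri
  linarith

end
end

section
/- Let (A,X) be a C*-correspondence and let (π⁰,π¹): (A,X) → B(H) be a covariant Toeplitz pair on a Hilbert space H. Let N be a contractive approximate unit for J_X consisting of positive elements. Then: (i) the net (π⁰(b))_{b∈N} converges in the strong operator topology to a projection P ∈ B(H) that commutes with π⁰(a) for every a ∈ A; and (ii) setting Q := 1 − P, for every Hilbert space K and every isometry V ∈ B(K), the maps τ⁰: A → B(H ⊗ K), a ↦ π⁰(a) ⊗ I, and τ_V¹: X → B(H ⊗ K), x ↦ Pπ¹(x) ⊗ I + Qπ¹(x) ⊗ V, form a covariant Toeplitz pair (τ⁰, τ_V¹): (A,X) → B(H ⊗ K). -/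
/-!
Common framework: Hilbert C*-modules, C*-correspondences, compact operators,
the Katsura ideal, Toeplitz pairs, covariance, Cuntz-Pimsner algebras,
completely positive completely contractive maps, and hyperrigidity.
-/

noncomputable section

open Filter Topology Set
open scoped ComplexOrder InnerProductSpace

universe u v w u'

/-- The C*-algebra order: `a ≼ b` iff `b - a` is positive. -/
def CStarLe {C : Type w} [NonUnitalCStarAlgebra C] (a b : C) : Prop :=
  ∃ c, b - a = star c * c

/-- `N` is a positive contractive approximate unit for (the closed two-sided
ideal) `J`, directed by the C*-order. -/
structure IsPosApproxUnit {C : Type w} [NonUnitalCStarAlgebra C]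
    (J : Set C) (N : Set C) : Prop where
  subset : N ⊆ J
  nonempty : N.Nonempty
  pos : ∀ b ∈ N, ∃ c, b = star c * c
  contractive : ∀ b ∈ N, ‖b‖ ≤ 1
  directed : ∀ b₁ ∈ N, ∀ b₂ ∈ N, ∃ b ∈ N, CStarLe b₁ b ∧ CStarLe b₂ b
  approx : ∀ a ∈ J, ∀ ε > (0 : ℝ), ∃ b₀ ∈ N, ∀ b ∈ N, CStarLe b₀ b →
    ‖b * a - a‖ < ε ∧ ‖a * b - a‖ < ε

/-- `P` is the limit of the net `(f b)_{b ∈ N}` (over the directed set `N`,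
ordered by the C*-order) in the strong operator topology on `B(H)`. -/
def IsSOTLimitAlong {C : Type w} [NonUnitalCStarAlgebra C]
    {H : Type u'} [NormedAddCommGroup H] [InnerProductSpace ℂ H] [CompleteSpace H]
    (N : Set C) (f : C → H →L[ℂ] H) (P : H →L[ℂ] H) : Prop :=
  ∀ h : H, ∀ ε > (0 : ℝ), ∃ b₀ ∈ N, ∀ b ∈ N, CStarLe b₀ b → ‖f b h - P h‖ < ε

/-- `tp : H → K → HK` realizes `HK` as the Hilbert space tensor product
`H ⊗ K`: it is bilinear, satisfies `⟪h⊗k, h'⊗k'⟫ = ⟪h,h'⟫⟪k,k'⟫`, and its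
range has dense linear span. -/
structure IsHilbertTensorProduct (H : Type u') (K : Type u') (HK : Type u')
    [NormedAddCommGroup H] [InnerProductSpace ℂ H] [CompleteSpace H]
    [NormedAddCommGroup K] [InnerProductSpace ℂ K] [CompleteSpace K]
    [NormedAddCommGroup HK] [InnerProductSpace ℂ HK] [CompleteSpace HK]
    (tp : H → K → HK) : Prop where
  add_left : ∀ h h' k, tp (h + h') k = tp h k + tp h' k
  add_right : ∀ h k k', tp h (k + k') = tp h k + tp h k'
  csmul_left : ∀ (z : ℂ) h k, tp (z • h) k = z • tp h k
  csmul_right : ∀ (z : ℂ) h k, tp h (z • k) = z • tp h k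
  inner_tp_tp : ∀ h h' k k', ⟪tp h k, tp h' k'⟫_ℂ = ⟪h, h'⟫_ℂ * ⟪k, k'⟫_ℂ
  dense_span :
    closure ((Submodule.span ℂ {v : HK | ∃ h k, v = tp h k} : Submodule ℂ HK) : Set HK)
      = Set.univ

theorem CStarLe.refl {C : Type w} [NonUnitalCStarAlgebra C] (a : C) : CStarLe a a :=
  ⟨0, by simp⟩

theorem CStarLe.trans {C : Type w} [NonUnitalCStarAlgebra C] {a b d : C}
    (hab : CStarLe a b) (hbd : CStarLe b d) : CStarLe a d := by
  let _ := CStarAlgebra.spectralOrder C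
  have := CStarAlgebra.spectralOrderedRing C
  obtain ⟨x, hx⟩ := hab
  obtain ⟨y, hy⟩ := hbd
  have h : 0 ≤ star x * x + star y * y :=
    add_nonneg (star_mul_self_nonneg x) (star_mul_self_nonneg y)
  obtain ⟨z, hz⟩ := CStarAlgebra.nonneg_iff_eq_star_mul_self.mp h
  exact ⟨z, by rw [← hz, ← hx, ← hy]; abel⟩

namespace IsPosApproxUnit

variable {C : Type w} [NonUnitalCStarAlgebra C] {J N : Set C}
  {H : Type u'} [NormedAddCommGroup H] [InnerProductSpace ℂ H] [CompleteSpace H]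

/-- The closed linear span of `π(J)H`. -/
def essentialSubspace (J : Set C) (π : C →⋆ₙₐ[ℂ] (H →L[ℂ] H)) : Submodule ℂ H :=
  (Submodule.span ℂ {z : H | ∃ a ∈ J, ∃ h : H, z = π a h}).topologicalClosure

instance (J : Set C) (π : C →⋆ₙₐ[ℂ] (H →L[ℂ] H)) : CompleteSpace (essentialSubspace J π) :=
  (Submodule.isClosed_topologicalClosure _).completeSpace_coe

theorem apply_mem_essentialSubspace (π : C →⋆ₙₐ[ℂ] (H →L[ℂ] H)) {a : C} (ha : a ∈ J) (h : H) :
    π a h ∈ essentialSubspace J π :=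
  Submodule.le_topologicalClosure _ (Submodule.subset_span ⟨a, ha, h, rfl⟩)

/-- A positive contractive approximate unit converges strongly to the identity on the essential
subspace of a representation. -/
theorem eventually_norm_apply_sub_lt (hN : IsPosApproxUnit J N) (π : C →⋆ₙₐ[ℂ] (H →L[ℂ] H))
    {h : H} (hh : h ∈ essentialSubspace J π) {ε : ℝ} (hε : 0 < ε) :
    ∃ b₀ ∈ N, ∀ b ∈ N, CStarLe b₀ b → ‖π b h - h‖ < ε := by
  have hspan : ∀ g ∈ Submodule.span ℂ {z : H | ∃ a ∈ J, ∃ h : H, z = π a h}, ∀ ε > (0 : ℝ),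
      ∃ b₀ ∈ N, ∀ b ∈ N, CStarLe b₀ b → ‖π b g - g‖ < ε := by
    intro g hg
    induction hg using Submodule.span_induction with
    | mem z hz =>
      obtain ⟨a, ha, k, rfl⟩ := hz
      intro ε hε
      obtain ⟨b₀, hb₀, hb⟩ := hN.approx a ha (ε / (‖k‖ + 1)) (by positivity)
      refine ⟨b₀, hb₀, fun b hbN hle => ?_⟩
      have heq : π b (π a k) - π a k = π (b * a - a) k := by simp [map_sub, map_mul]
      rw [heq]
      calc ‖π (b * a - a) k‖ ≤ ‖π (b * a - a)‖ * ‖k‖ := ContinuousLinearMap.le_opNorm _ _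
        _ ≤ ‖b * a - a‖ * (‖k‖ + 1) := by
          gcongr
          · exact NonUnitalStarAlgHom.norm_apply_le π _
          · linarith
        _ < ε / (‖k‖ + 1) * (‖k‖ + 1) := by
          have := (hb b hbN hle).1
          gcongr
        _ = ε := by field_simp
    | zero =>
      intro ε hε
      obtain ⟨b, hb⟩ := hN.nonempty
      exact ⟨b, hb, fun b _ _ => by simpa using hε⟩
    | add x y _ _ hx hy =>
      intro ε hε
      obtain ⟨b₁, hb₁, h₁⟩ := hx (ε / 2) (half_pos hε)
      obtain ⟨b₂, hb₂, h₂⟩ := hy (ε / 2) (half_pos hε)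
      obtain ⟨b₀, hb₀, h₁₀, h₂₀⟩ := hN.directed b₁ hb₁ b₂ hb₂
      refine ⟨b₀, hb₀, fun b hb hle => ?_⟩
      have e₁ := h₁ b hb (h₁₀.trans hle)
      have e₂ := h₂ b hb (h₂₀.trans hle)
      calc ‖π b (x + y) - (x + y)‖ = ‖(π b x - x) + (π b y - y)‖ := by
            rw [map_add]; congr 1; abel
        _ ≤ ‖π b x - x‖ + ‖π b y - y‖ := norm_add_le _ _
        _ < ε := by linarith
    | smul c x _ hx =>
      intro ε hε
      obtain ⟨b₀, hb₀, h₀⟩ := hx (ε / (‖c‖ + 1)) (by positivity)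
      refine ⟨b₀, hb₀, fun b hb hle => ?_⟩
      have e := h₀ b hb hle
      rw [map_smul, ← smul_sub, norm_smul]
      calc ‖c‖ * ‖π b x - x‖ ≤ (‖c‖ + 1) * ‖π b x - x‖ := by gcongr; linarith
        _ < (‖c‖ + 1) * (ε / (‖c‖ + 1)) := by gcongr
        _ = ε := by field_simp
  obtain ⟨g, hg, hgh⟩ := Metric.mem_closure_iff.mp
    (show h ∈ closure (Submodule.span ℂ {z : H | ∃ a ∈ J, ∃ h : H, z = π a h} : Set H) from hh)
    (ε / 3) (by positivity)
  rw [dist_eq_norm] at hgh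
  obtain ⟨b₀, hb₀, hb⟩ := hspan g hg (ε / 3) (by positivity)
  refine ⟨b₀, hb₀, fun b hbN hle => ?_⟩
  have e := hb b hbN hle
  have hπ : ‖π b (h - g)‖ ≤ ‖h - g‖ :=
    calc ‖π b (h - g)‖ ≤ ‖π b‖ * ‖h - g‖ := ContinuousLinearMap.le_opNorm _ _
      _ ≤ 1 * ‖h - g‖ := by
        gcongr
        exact (NonUnitalStarAlgHom.norm_apply_le π b).trans (hN.contractive b hbN)
      _ = ‖h - g‖ := one_mul _
  calc ‖π b h - h‖ = ‖π b (h - g) + (π b g - g) - (h - g)‖ := by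
        rw [map_sub]; congr 1; abel
    _ ≤ ‖π b (h - g)‖ + ‖π b g - g‖ + ‖h - g‖ :=
        (norm_sub_le _ _).trans (by gcongr; exact norm_add_le _ _)
    _ < ε := by linarith

theorem isSOTLimitAlong_starProjection (hN : IsPosApproxUnit J N)
    (π : C →⋆ₙₐ[ℂ] (H →L[ℂ] H)) :
    IsSOTLimitAlong N (fun b => π b) (essentialSubspace J π).starProjection := by
  intro h ε hε
  set E := essentialSubspace J π
  obtain ⟨b₀, hb₀, hb⟩ := hN.eventually_norm_apply_sub_lt π
    (Submodule.starProjection_apply_mem E h) hε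
  refine ⟨b₀, hb₀, fun b hbN hle => ?_⟩
  have hker : π b (h - E.starProjection h) = 0 := by
    obtain ⟨x, hx⟩ := hN.pos b hbN
    have hsa : star (π b) = π b := by rw [← map_star, hx]; simp
    refine ext_inner_right ℂ fun k => ?_
    rw [← hsa, ContinuousLinearMap.star_eq_adjoint, ContinuousLinearMap.adjoint_inner_left,
      inner_zero_left]
    exact Submodule.inner_left_of_mem_orthogonal
      (apply_mem_essentialSubspace π (hN.subset hbN) k)
      (Submodule.sub_starProjection_mem_orthogonal h)
  rw [map_sub, sub_eq_zero] at hker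
  rw [hker]
  exact hb b hbN hle

theorem starProjection_mul (π : C →⋆ₙₐ[ℂ] (H →L[ℂ] H)) {a : C} (ha : a ∈ J) :
    (essentialSubspace J π).starProjection * π a = π a := by
  ext h
  exact Submodule.starProjection_eq_self_iff.mpr (apply_mem_essentialSubspace π ha h)

theorem commute_starProjection (hJ : ∀ a, ∀ b ∈ J, a * b ∈ J) (π : C →⋆ₙₐ[ℂ] (H →L[ℂ] H))
    (a : C) : Commute (π a) (essentialSubspace J π).starProjection := by
  set E := essentialSubspace J π
  have hinv : ∀ a, ∀ h ∈ E, π a h ∈ E := by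
    intro a h hh
    have hle : (Submodule.span ℂ {z : H | ∃ a ∈ J, ∃ h : H, z = π a h}) ≤
        E.comap (π a).toLinearMap := by
      rw [Submodule.span_le]
      rintro _ ⟨b, hb, k, rfl⟩
      have : π a (π b k) = π (a * b) k := by rw [map_mul]; rfl
      simp only [SetLike.mem_coe, Submodule.mem_comap, ContinuousLinearMap.coe_coe, this]
      exact apply_mem_essentialSubspace π (hJ a b hb) k
    exact Submodule.topologicalClosure_minimal _ hle
      ((Submodule.isClosed_topologicalClosure _).preimage (π a).continuous) hh
  have hcomp : ∀ a, E.starProjection * π a * E.starProjection = π a * E.starProjection := by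
    intro a
    ext h
    exact Submodule.starProjection_eq_self_iff.mpr
      (hinv a _ (Submodule.starProjection_apply_mem E h))
  have hsa : star E.starProjection = E.starProjection := isSelfAdjoint_starProjection E
  have h₁ := congrArg star (hcomp (star a))
  simp only [star_mul, hsa, map_star, star_star] at h₁
  rw [← mul_assoc] at h₁
  exact (hcomp a).symm.trans h₁

end IsPosApproxUnit

namespace Correspondence

variable {A : Type u} {X : Type v} [NonUnitalCStarAlgebra A]
  [NormedAddCommGroup X] [NormedSpace ℂ X] [CompleteSpace X]

theorem lact_comp_mem_compacts (c : Correspondence A X) (a : A) {k : X →L[ℂ] X}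
    (hk : k ∈ c.toHilbertModule.compacts) : (c.lact a).comp k ∈ c.toHilbertModule.compacts := by
  let L : (X →L[ℂ] X) →L[ℂ] (X →L[ℂ] X) := ContinuousLinearMap.compL ℂ X X X (c.lact a)
  have hle : Submodule.span ℂ (Set.range fun p : X × X => c.toHilbertModule.rankOne p.1 p.2) ≤
      c.toHilbertModule.compacts.comap L.toLinearMap := by
    rw [Submodule.span_le]
    rintro _ ⟨p, rfl⟩
    have : L (c.toHilbertModule.rankOne p.1 p.2) =
        c.toHilbertModule.rankOne (c.lact a p.1) p.2 := by
      ext z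
      exact c.lact_smulR a p.1 _
    simp only [SetLike.mem_coe, Submodule.mem_comap, ContinuousLinearMap.coe_coe, this]
    exact c.toHilbertModule.rankOne_mem_compacts _ _
  exact Submodule.topologicalClosure_minimal _ hle
    ((Submodule.isClosed_topologicalClosure _).preimage L.continuous) hk

theorem mul_mem_katsura (c : Correspondence A X) (a : A) {b : A} (hb : b ∈ c.katsura) :
    a * b ∈ c.katsura := by
  refine ⟨?_, fun d hd => ?_⟩
  · rw [c.lact_mul]
    exact c.lact_comp_mem_compacts a hb.1
  · rw [mul_assoc, hb.2 d hd, mul_zero]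

end Correspondence

namespace IsHilbertTensorProduct

variable {H K HK : Type u'}
  [NormedAddCommGroup H] [InnerProductSpace ℂ H] [CompleteSpace H]
  [NormedAddCommGroup K] [InnerProductSpace ℂ K] [CompleteSpace K]
  [NormedAddCommGroup HK] [InnerProductSpace ℂ HK] [CompleteSpace HK]
  {tp : H → K → HK}

theorem clm_ext (htp : IsHilbertTensorProduct H K HK tp) {S T : HK →L[ℂ] HK}
    (h : ∀ x y, S (tp x y) = T (tp x y)) : S = T := by
  refine ContinuousLinearMap.ext_on (dense_iff_closure_eq.mpr htp.dense_span) ?_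
  rintro _ ⟨x, y, rfl⟩
  exact h x y

theorem vec_ext (htp : IsHilbertTensorProduct H K HK tp) {v w : HK}
    (h : ∀ x y, ⟪v, tp x y⟫_ℂ = ⟪w, tp x y⟫_ℂ) : v = w := by
  have : innerSL ℂ v = innerSL ℂ w := by
    refine ContinuousLinearMap.ext_on (dense_iff_closure_eq.mpr htp.dense_span) ?_
    rintro _ ⟨x, y, rfl⟩
    exact h x y
  exact ext_inner_right ℂ fun u => congrArg (fun f : HK →L[ℂ] ℂ => f u) this

open TensorProduct in
/-- The isometric embedding of the algebraic tensor product. -/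
def lift (htp : IsHilbertTensorProduct H K HK tp) : H ⊗[ℂ] K →ₗᵢ[ℂ] HK :=
  LinearMap.isometryOfInner
    (TensorProduct.lift
      (LinearMap.mk₂ ℂ tp htp.add_left htp.csmul_left htp.add_right htp.csmul_right))
    (by
      intro x y
      induction x with
      | zero => simp
      | add x₁ x₂ h₁ h₂ => simp only [map_add, inner_add_left, h₁, h₂]
      | tmul h k =>
        induction y with
        | zero => simp
        | add y₁ y₂ h₁ h₂ => simp only [map_add, inner_add_right, h₁, h₂]
        | tmul h' k' => simp [htp.inner_tp_tp])

open TensorProduct in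
@[simp]
theorem lift_tmul (htp : IsHilbertTensorProduct H K HK tp) (h : H) (k : K) :
    htp.lift (h ⊗ₜ k) = tp h k := by
  simp [lift]

theorem denseRange_lift (htp : IsHilbertTensorProduct H K HK tp) : DenseRange htp.lift := by
  have hle : Submodule.span ℂ {v : HK | ∃ h k, v = tp h k} ≤ htp.lift.toLinearMap.range := by
    rw [Submodule.span_le]
    rintro _ ⟨h, k, rfl⟩
    exact ⟨_, htp.lift_tmul h k⟩
  exact (dense_iff_closure_eq.mpr htp.dense_span).mono hle

/-- The operator `S ⊗ R` on the Hilbert space tensor product. -/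
def map (htp : IsHilbertTensorProduct H K HK tp) (S : H →L[ℂ] H) (R : K →L[ℂ] K) :
    HK →L[ℂ] HK :=
  (htp.lift.toContinuousLinearMap.comp (TensorProduct.mapL S R)).extend
    htp.lift.toContinuousLinearMap

@[simp]
theorem map_tp (htp : IsHilbertTensorProduct H K HK tp) (S : H →L[ℂ] H) (R : K →L[ℂ] K)
    (h : H) (k : K) : htp.map S R (tp h k) = tp (S h) (R k) := by
  have := ContinuousLinearMap.extend_eq
    (htp.lift.toContinuousLinearMap.comp (TensorProduct.mapL S R))
    (e := htp.lift.toContinuousLinearMap) htp.denseRange_lift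
    htp.lift.isometry.isUniformInducing (h ⊗ₜ k)
  simpa [map] using this

theorem map_mul_map (htp : IsHilbertTensorProduct H K HK tp) (S S' : H →L[ℂ] H)
    (R R' : K →L[ℂ] K) : htp.map S R * htp.map S' R' = htp.map (S * S') (R * R') :=
  htp.clm_ext fun x y => by simp

theorem star_map (htp : IsHilbertTensorProduct H K HK tp) (S : H →L[ℂ] H) (R : K →L[ℂ] K) :
    star (htp.map S R) = htp.map (star S) (star R) := by
  refine htp.clm_ext fun x y => htp.vec_ext fun x' y' => ?_
  simp [ContinuousLinearMap.star_eq_adjoint, ContinuousLinearMap.adjoint_inner_left,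
    htp.inner_tp_tp]

theorem map_one_one (htp : IsHilbertTensorProduct H K HK tp) : htp.map 1 1 = 1 :=
  htp.clm_ext fun x y => by simp

/-- The amplification `S ↦ S ⊗ I` as a *-homomorphism. -/
def amplification (htp : IsHilbertTensorProduct H K HK tp) :
    (H →L[ℂ] H) →⋆ₙₐ[ℂ] (HK →L[ℂ] HK) where
  toFun S := htp.map S 1
  map_smul' z S := htp.clm_ext fun x y => by simp [htp.csmul_left]
  map_zero' := htp.clm_ext fun x y => by simpa using htp.csmul_left 0 0 y
  map_add' S S' := htp.clm_ext fun x y => by simp [htp.add_left]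
  map_mul' S S' := by rw [htp.map_mul_map, one_mul]
  map_star' S := by rw [htp.star_map, star_one]

@[simp]
theorem amplification_tp (htp : IsHilbertTensorProduct H K HK tp) (S : H →L[ℂ] H)
    (h : H) (k : K) : htp.amplification S (tp h k) = tp (S h) k := by
  simp [amplification]

end IsHilbertTensorProduct

namespace ToeplitzPair

variable {A : Type u} {X : Type v} [NonUnitalCStarAlgebra A]
  [NormedAddCommGroup X] [NormedSpace ℂ X] [CompleteSpace X] {c : Correspondence A X}
  {C : Type w} [NonUnitalCStarAlgebra C] {D : Type u'} [CStarAlgebra D]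

/-- The Toeplitz pair `(ρ ∘ π⁰, U (ρ ∘ π¹))` for a *-homomorphism `ρ` and an isometry `U`
commuting with the range of `ρ ∘ π⁰`. -/
def twist (T : ToeplitzPair c C) (ρ : C →⋆ₙₐ[ℂ] D) (U : D) (hU : star U * U = 1)
    (hcomm : ∀ a, Commute (ρ (T.p0 a)) U) : ToeplitzPair c D where
  p0 := ρ.comp T.p0
  p1 := (LinearMap.mulLeft ℂ U).comp ((ρ : C →ₗ[ℂ] D).comp T.p1)
  p0_mul_p1 a x := by
    simp only [NonUnitalStarAlgHom.comp_apply, LinearMap.comp_apply, LinearMap.mulLeft_apply,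
      LinearMap.coe_coe, ← T.p0_mul_p1, map_mul]
    rw [← mul_assoc, (hcomm a).eq, mul_assoc]
  star_p1_mul_p1 x y := by
    simp only [NonUnitalStarAlgHom.comp_apply, LinearMap.comp_apply, LinearMap.mulLeft_apply,
      LinearMap.coe_coe, ← T.star_p1_mul_p1, map_mul, map_star, star_mul]
    rw [mul_assoc, ← mul_assoc (star U), hU, one_mul]

theorem IsCovariant.twist {T : ToeplitzPair c C} (hT : T.IsCovariant) (ρ : C →⋆ₙₐ[ℂ] D) (U : D)
    (hU : star U * U = 1) (hcomm : ∀ a, Commute (ρ (T.p0 a)) U)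
    (hkatsura : ∀ a ∈ c.katsura, U * ρ (T.p0 a) * star U = ρ (T.p0 a)) :
    (T.twist ρ U hU hcomm).IsCovariant := by
  obtain ⟨Φ, hΦ, hcov⟩ := hT
  let ρ' : C →L[ℂ] D := (ρ : C →ₗ[ℂ] D).mkContinuous 1
    fun x => by simpa using NonUnitalStarAlgHom.norm_apply_le ρ x
  refine ⟨((ContinuousLinearMap.mul ℂ D).flip (star U)).comp
    ((ContinuousLinearMap.mul ℂ D U).comp (ρ'.comp Φ)), fun x y => ?_, fun a ha => ?_⟩
  · change U * ρ (Φ _) * star U = U * ρ (T.p1 x) * star (U * ρ (T.p1 y))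
    rw [hΦ, map_mul, map_star, star_mul]
    simp only [mul_assoc]
  · change ρ (T.p0 a) = U * ρ (Φ _) * star U
    rw [← hcov a ha, hkatsura a ha]

end ToeplitzPair

/-- Let `(π⁰, π¹)` be a covariant Toeplitz pair of `(A, X)` on
`H` and let `N` be a positive contractive approximate unit for `J_X`.  Then
(i) the net `(π⁰(b))_{b ∈ N}` converges strongly to a projection `P` commuting
with every `π⁰(a)`, and (ii) with `Q := 1 - P`, for every Hilbert space `K`
and isometry `V ∈ B(K)`, the maps `τ⁰ : a ↦ π⁰(a) ⊗ I` and
`τ_V¹ : x ↦ Pπ¹(x) ⊗ I + Qπ¹(x) ⊗ V` (characterized by their action on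
elementary tensors of `H ⊗ K`) form a covariant Toeplitz pair on `H ⊗ K`. -/
theorem sotLimit_projection_and_covariant_pair
    {A : Type u} {X : Type v} [NonUnitalCStarAlgebra A] [NormedAddCommGroup X]
    [NormedSpace ℂ X] [CompleteSpace X] (c : Correspondence A X)
    {H : Type u'} [NormedAddCommGroup H] [InnerProductSpace ℂ H] [CompleteSpace H]
    (T : ToeplitzPair c (H →L[ℂ] H)) (hT : T.IsCovariant)
    (N : Set A) (hN : IsPosApproxUnit c.katsura N) :
    ∃ P : H →L[ℂ] H,
      IsSOTLimitAlong N (fun b => T.p0 b) P ∧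
      IsIdempotentElem P ∧ IsSelfAdjoint P ∧
      (∀ a : A, Commute (T.p0 a) P) ∧
      ∀ (K HK : Type u') [NormedAddCommGroup K] [InnerProductSpace ℂ K]
        [CompleteSpace K] [NormedAddCommGroup HK] [InnerProductSpace ℂ HK]
        [CompleteSpace HK] (tp : H → K → HK), IsHilbertTensorProduct H K HK tp →
        ∀ V : K →L[ℂ] K, (∀ k k', ⟪V k, V k'⟫_ℂ = ⟪k, k'⟫_ℂ) →
          ∃ τ : ToeplitzPair c (HK →L[ℂ] HK), τ.IsCovariant ∧
            (∀ (a : A) (h : H) (k : K), τ.p0 a (tp h k) = tp (T.p0 a h) k) ∧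
            (∀ (x : X) (h : H) (k : K), τ.p1 x (tp h k)
              = tp (P (T.p1 x h)) k + tp (((1 : H →L[ℂ] H) - P) (T.p1 x h)) (V k)) := by
  set P := (IsPosApproxUnit.essentialSubspace c.katsura T.p0).starProjection
  have hPP : P * P = P := Submodule.isIdempotentElem_starProjection _
  have hPs : star P = P := isSelfAdjoint_starProjection _
  have hcomm : ∀ a, Commute (T.p0 a) P :=
    IsPosApproxUnit.commute_starProjection (fun a b hb => c.mul_mem_katsura a hb) T.p0
  refine ⟨P, hN.isSOTLimitAlong_starProjection T.p0, hPP, hPs, hcomm, ?_⟩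
  intro K HK _ _ _ _ _ _ tp htp V hV
  have hVV : star V * V = 1 := by
    ext k
    refine ext_inner_right ℂ fun k' => ?_
    simp [ContinuousLinearMap.star_eq_adjoint, ContinuousLinearMap.adjoint_inner_left, hV]
  have hU : star (htp.map P 1 + htp.map (1 - P) V) * (htp.map P 1 + htp.map (1 - P) V) = 1 := by
    refine htp.clm_ext fun x y => ?_
    have h₀ : P * (1 - P) = 0 := by rw [mul_sub, hPP, mul_one, sub_self]
    have h₁ : (1 - P) * P = 0 := by rw [sub_mul, hPP, one_mul, sub_self]
    have h₂ : (1 - P) * (1 - P) = 1 - P := by rw [sub_mul, h₀, one_mul, sub_zero]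
    have htp₀ : ∀ k, tp 0 k = 0 := fun k => by simpa using htp.csmul_left 0 0 k
    simp only [star_add, htp.star_map, star_sub, star_one, hPs, add_mul, mul_add,
      htp.map_mul_map, hPP, h₀, h₁, h₂, hVV, one_mul, mul_one]
    simp [htp₀, ← htp.add_left]
  have hUcomm : ∀ a, Commute (htp.amplification (T.p0 a))
      (htp.map P 1 + htp.map (1 - P) V) := by
    intro a
    change htp.map _ 1 * _ = _ * htp.map _ 1
    simp only [mul_add, add_mul, htp.map_mul_map, one_mul, mul_one]
    rw [(hcomm a).eq, ((Commute.one_right _).sub_right (hcomm a)).eq]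
  have hUkat : ∀ a ∈ c.katsura, (htp.map P 1 + htp.map (1 - P) V) * htp.amplification (T.p0 a) *
      star (htp.map P 1 + htp.map (1 - P) V) = htp.amplification (T.p0 a) := by
    intro a ha
    have h₁ : P * T.p0 a = T.p0 a := IsPosApproxUnit.starProjection_mul T.p0 ha
    have h₂ : T.p0 a * P = T.p0 a := (hcomm a).eq.trans h₁
    refine htp.clm_ext fun x y => ?_
    have htp₀ : ∀ k, tp 0 k = 0 := fun k => by simpa using htp.csmul_left 0 0 k
    change (_ * htp.map _ 1 * _) _ = htp.map _ 1 _
    simp only [star_add, htp.star_map, star_sub, star_one, hPs, add_mul, mul_add,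
      htp.map_mul_map, sub_mul, mul_sub, h₁, h₂, one_mul, mul_one, sub_self]
    simp [htp₀]
  refine ⟨T.twist htp.amplification _ hU hUcomm, hT.twist _ _ hU hUcomm hUkat,
    fun a h k => htp.amplification_tp _ h k, fun x h k => ?_⟩
  change (htp.map P 1 + htp.map (1 - P) V) (htp.amplification (T.p1 x) (tp h k)) = _
  simp

end
end
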